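/- arXiv:2011.13442 — 4 statements merged into one kernel-verified Lean document; each statement's English description precedes it below -/
import Mathlib

section
/- Assume the RPE setup. If N_k ≥ 2·N_{k−1} for some 1 ≤ k ≤ K, then Φ_k ⊆ Φ_{k−1}. Consequently, if N_k ≥ 2·N_{k−1} holds for all 1 ≤ k ≤ K, then ∩_{k≤K} Φ_k = Φ_K, and in particular this intersection is nonempty. -/
open Real Metric Set

/-- The candidate set `Θ(N, φ)`: image on the circle `ℝ/2πℤ` of `{(φ + 2πn)/N : n ∈ ℤ}`. -/
noncomputable def candSet (N : ℕ) (φ : ℝ) : Set (AddCircle (2 * π)) :=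
  {x | ∃ n : ℤ, x = (((φ + 2 * π * n) / N : ℝ) : AddCircle (2 * π))}

/-- The RPE setup: strictly increasing sequence of integers `N` with `N 0 = 1`,
phases `φ`, candidate sets `Θ k = candSet (N k) (φ k)`, and RPE estimates `θhat k`,
where `θhat 0` is the unique element of `Θ 0` and `θhat k` is an element of `Θ k`
of minimal circular distance from `θhat (k-1)`. -/
structure RPE (K : ℕ) where
  N : ℕ → ℕ
  φ : ℕ → ℝ
  θhat : ℕ → AddCircle (2 * π)
  hN0 : N 0 = 1
  hNlt : ∀ k, k < K → N k < N (k + 1)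
  hmem : ∀ k, k ≤ K → θhat k ∈ candSet (N k) (φ k)
  hmin : ∀ k, 1 ≤ k → k ≤ K →
    ∀ x ∈ candSet (N k) (φ k), dist (θhat (k - 1)) (θhat k) ≤ dist (θhat (k - 1)) x

namespace RPE

variable {K : ℕ}

/-- The candidate set at generation `k`. -/
noncomputable def Θ (r : RPE K) (k : ℕ) : Set (AddCircle (2 * π)) :=
  candSet (r.N k) (r.φ k)

/-- Plausibly consistent angles at generation `k`. -/
noncomputable def Φ (r : RPE K) (k : ℕ) : Set (AddCircle (2 * π)) :=
  {θ | dist θ (r.θhat k) < π / (r.N k : ℝ)}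

/-- Consecutively consistent angles at generation `k` (`Λ 0` is the whole circle). -/
noncomputable def Λ (r : RPE K) (k : ℕ) : Set (AddCircle (2 * π)) :=
  if k = 0 then Set.univ
  else {θ | infDist θ (r.Θ k) + infDist θ (r.Θ (k - 1)) < π / (r.N k : ℝ)}

/-- Locally consistent angles at generation `k` with angular error bound `δθ`. -/
noncomputable def Δ (r : RPE K) (k : ℕ) (δθ : ℝ) : Set (AddCircle (2 * π)) :=
  {θ | infDist θ (r.Θ k) < δθ / (r.N k : ℝ)}

end RPE

/-- Every point of the circle is within half a spacing `π / N` of the candidate set. -/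
lemma exists_mem_candSet_dist_le {N : ℕ} (hN : 0 < N) (φ : ℝ) (x : AddCircle (2 * π)) :
    ∃ y ∈ candSet N φ, dist x y ≤ π / N := by
  obtain ⟨t, rfl⟩ := QuotientAddGroup.mk_surjective x
  have hN' : (0 : ℝ) < N := by exact_mod_cast hN
  have hπ := Real.pi_pos
  set u : ℝ := (N * t - φ) / (2 * π) with hu
  refine ⟨_, ⟨round u, rfl⟩, ?_⟩
  have hdiff : t - (φ + 2 * π * round u) / N = 2 * π / N * (u - round u) := by
    rw [hu]
    field_simp
    ring
  calc dist (t : AddCircle (2 * π)) (((φ + 2 * π * round u) / N : ℝ) : AddCircle (2 * π))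
      = ‖((t - (φ + 2 * π * round u) / N : ℝ) : AddCircle (2 * π))‖ := by
        rw [dist_eq_norm, AddCircle.coe_sub]
    _ ≤ ‖t - (φ + 2 * π * round u) / N‖ := QuotientAddGroup.norm_mk_le_norm
    _ = 2 * π / N * |u - round u| := by
        rw [hdiff, Real.norm_eq_abs, abs_mul, abs_of_pos (by positivity)]
    _ ≤ 2 * π / N * (1 / 2) := by gcongr; exact abs_sub_round u
    _ = π / N := by ring

namespace RPE

lemma N_pos {K : ℕ} (r : RPE K) {k : ℕ} (hk : k ≤ K) : 0 < r.N k := by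
  cases k with
  | zero => simp [r.hN0]
  | succ k => exact (Nat.zero_le _).trans_lt (r.hNlt k hk)

lemma dist_θhat_pred_le {K : ℕ} (r : RPE K) {k : ℕ} (hk : 1 ≤ k) (hkK : k ≤ K) :
    dist (r.θhat (k - 1)) (r.θhat k) ≤ π / r.N k := by
  obtain ⟨y, hy, hd⟩ := exists_mem_candSet_dist_le (r.N_pos hkK) (r.φ k) (r.θhat (k - 1))
  exact (r.hmin k hk hkK y hy).trans hd

lemma Φ_subset_pred {K : ℕ} (r : RPE K) {k : ℕ} (hk : 1 ≤ k) (hkK : k ≤ K)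
    (h : 2 * r.N (k - 1) ≤ r.N k) : r.Φ k ⊆ r.Φ (k - 1) := by
  intro θ hθ
  have hpos : (0 : ℝ) < r.N (k - 1) := by exact_mod_cast r.N_pos (by omega)
  have h' : 2 * (r.N (k - 1) : ℝ) ≤ r.N k := by exact_mod_cast h
  have hθ' : dist θ (r.θhat k) < π / r.N k := hθ
  have hstep := r.dist_θhat_pred_le hk hkK
  rw [dist_comm] at hstep
  calc dist θ (r.θhat (k - 1))
      ≤ dist θ (r.θhat k) + dist (r.θhat k) (r.θhat (k - 1)) := dist_triangle _ _ _
    _ < π / r.N k + π / r.N k := add_lt_add_of_lt_of_le hθ' hstep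
    _ = 2 * (π / r.N k) := by ring
    _ ≤ 2 * (π / (2 * r.N (k - 1))) := by gcongr
    _ = π / r.N (k - 1) := by field_simp

lemma θhat_mem_Φ {K : ℕ} (r : RPE K) {k : ℕ} (hk : k ≤ K) : r.θhat k ∈ r.Φ k := by
  have hpos : (0 : ℝ) < r.N k := by exact_mod_cast r.N_pos hk
  change dist (r.θhat k) (r.θhat k) < π / r.N k
  rw [dist_self]
  positivity

end RPE

/-- In the RPE setup: if `N k ≥ 2 N (k-1)` for some `1 ≤ k ≤ K`, then
`Φ k ⊆ Φ (k-1)`.  Consequently, if `N k ≥ 2 N (k-1)` for all `1 ≤ k ≤ K`, then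
`⋂_{k ≤ K} Φ k = Φ K`; in particular, this intersection is nonempty. -/
theorem stmt3 (K : ℕ) (r : RPE K) :
    (∀ k, 1 ≤ k → k ≤ K → 2 * r.N (k - 1) ≤ r.N k → r.Φ k ⊆ r.Φ (k - 1)) ∧
    ((∀ k, 1 ≤ k → k ≤ K → 2 * r.N (k - 1) ≤ r.N k) →
      (⋂ k ∈ Set.Iic K, r.Φ k) = r.Φ K ∧ (⋂ k ∈ Set.Iic K, r.Φ k).Nonempty) := by
  refine ⟨fun k hk hkK h => r.Φ_subset_pred hk hkK h, fun h => ?_⟩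
  have hsub : ∀ k ≤ K, r.Φ K ⊆ r.Φ k := fun k hk =>
    Nat.decreasingInduction' (P := fun j => r.Φ K ⊆ r.Φ j)
      (fun j hj _ ih => ih.trans (r.Φ_subset_pred (k := j + 1) (by omega) hj (h _ (by omega) hj)))
      hk subset_rfl
  have heq : (⋂ k ∈ Set.Iic K, r.Φ k) = r.Φ K :=
    (Set.biInter_subset_of_mem (Set.mem_Iic.2 le_rfl)).antisymm (Set.subset_iInter₂ hsub)
  exact ⟨heq, heq ▸ ⟨_, r.θhat_mem_Φ le_rfl⟩⟩
end

section
/- For all integers j ≥ 0 and k ≥ 0, the fractional part F(x) = x − ⌊x⌋ of 2^k · (2^{−j}/3) satisfies |F(2^k · 2^{−j}/3) − 1/2| ≥ 1/6. (Indeed F(2^k · 2^{−j}/3) equals 2^{k−j}/3 < 1/3 if k < j, and equals 1/3 or 2/3 if k ≥ j.) -/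
open Real

/-- A power of two is never divisible by three, so a third of it has fractional part
`1 / 3` or `2 / 3`. -/
theorem fract_two_pow_div_three (n : ℕ) :
    Int.fract ((2 : ℝ) ^ n / 3) = 1 / 3 ∨ Int.fract ((2 : ℝ) ^ n / 3) = 2 / 3 := by
  induction n with
  | zero => left; rw [Int.fract_eq_iff]; exact ⟨by norm_num, by norm_num, 0, by norm_num⟩
  | succ n ih =>
    rcases ih with h | h
    · right
      obtain ⟨-, -, z, hz⟩ := Int.fract_eq_iff.1 h
      refine Int.fract_eq_iff.2 ⟨by norm_num, by norm_num, 2 * z, ?_⟩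
      push_cast
      rw [← hz]
      ring
    · left
      obtain ⟨-, -, z, hz⟩ := Int.fract_eq_iff.1 h
      refine Int.fract_eq_iff.2 ⟨by norm_num, by norm_num, 2 * z + 1, ?_⟩
      push_cast
      rw [← hz]
      ring

/-- For all integers `j, k ≥ 0`, the fractional part of `2^k · (2^{-j}/3)`
satisfies `|F(2^k · 2^{-j}/3) - 1/2| ≥ 1/6`.  Indeed, it equals `2^{k-j}/3 < 1/3`
if `k < j`, and equals `1/3` or `2/3` if `k ≥ j`. -/
theorem stmt15 (j k : ℕ) :
    (1 / 6 : ℝ) ≤ |Int.fract ((2 : ℝ) ^ k * ((2 : ℝ) ^ (-(j : ℤ)) / 3)) - 1 / 2| ∧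
    (k < j → Int.fract ((2 : ℝ) ^ k * ((2 : ℝ) ^ (-(j : ℤ)) / 3)) =
      (2 : ℝ) ^ ((k : ℤ) - (j : ℤ)) / 3 ∧ (2 : ℝ) ^ ((k : ℤ) - (j : ℤ)) / 3 < 1 / 3) ∧
    (j ≤ k → Int.fract ((2 : ℝ) ^ k * ((2 : ℝ) ^ (-(j : ℤ)) / 3)) = 1 / 3 ∨
      Int.fract ((2 : ℝ) ^ k * ((2 : ℝ) ^ (-(j : ℤ)) / 3)) = 2 / 3) := by
  have hpow : (2 : ℝ) ^ k * ((2 : ℝ) ^ (-(j : ℤ)) / 3) = (2 : ℝ) ^ ((k : ℤ) - (j : ℤ)) / 3 := by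
    rw [sub_eq_add_neg, zpow_add₀ two_ne_zero, zpow_natCast, mul_div_assoc]
  rw [hpow]
  have hlt : k < j → Int.fract ((2 : ℝ) ^ ((k : ℤ) - (j : ℤ)) / 3) =
      (2 : ℝ) ^ ((k : ℤ) - (j : ℤ)) / 3 ∧ (2 : ℝ) ^ ((k : ℤ) - (j : ℤ)) / 3 < 1 / 3 := by
    intro h
    have hone : (2 : ℝ) ^ ((k : ℤ) - (j : ℤ)) < 1 :=
      zpow_lt_one_of_neg₀ one_lt_two (by omega)
    exact ⟨Int.fract_eq_self.2 ⟨by positivity, by linarith⟩, by linarith⟩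
  have hle : j ≤ k → Int.fract ((2 : ℝ) ^ ((k : ℤ) - (j : ℤ)) / 3) = 1 / 3 ∨
      Int.fract ((2 : ℝ) ^ ((k : ℤ) - (j : ℤ)) / 3) = 2 / 3 := by
    intro h
    rw [← Nat.cast_sub h, zpow_natCast]
    exact fract_two_pow_div_three (k - j)
  refine ⟨?_, hlt, hle⟩
  rw [le_abs]
  rcases lt_or_ge k j with h | h
  · obtain ⟨heq, hthird⟩ := hlt h
    right
    linarith
  · rcases hle h with heq | heq
    · right
      linarith
    · left
      linarith
end

section
/- (Counterexample to relaxed set-formulation RPE.) Let α > 1/6, let j ≥ 0 be an integer, and set φ = 2^{−j}/3. Then for every integer k ≥ 0 there exist a real number ε with |ε| ≤ α and an integer q such that |q + ε − φ·2^k| < α. Consequently, with measured candidate sets at generation k given by {2π(q + ε_k)/2^k : q ∈ ℤ} (errors |ε_k| ≤ α, true angle 0), the false angle 2πφ lies within circular distance 2πα·2^{−k} of the candidate set at every generation k. -/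
open Real

/-- The circular distance between two angles is at most the distance of their representatives. -/
lemma AddCircle.dist_coe_le_abs_sub (p x y : ℝ) :
    dist (x : AddCircle p) (y : AddCircle p) ≤ |x - y| := by
  rw [dist_eq_norm, ← AddCircle.coe_sub, ← Real.norm_eq_abs]
  exact QuotientAddGroup.norm_mk_le_norm

/-- An integral multiple of `1 / 3` is within `1 / 3` of an integer. -/
lemma exists_int_abs_div_three_sub_le (n : ℤ) : ∃ q : ℤ, |(n : ℝ) / 3 - q| ≤ 1 / 3 := by
  obtain ⟨q, h₁, h₂⟩ : ∃ q : ℤ, n - 3 * q ≤ 1 ∧ -1 ≤ n - 3 * q :=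
    ⟨(n + 1) / 3, by omega, by omega⟩
  have h₁' : (n : ℝ) - 3 * q ≤ 1 := by exact_mod_cast h₁
  have h₂' : (-1 : ℝ) ≤ n - 3 * q := by exact_mod_cast h₂
  exact ⟨q, abs_le.2 ⟨by linarith, by linarith⟩⟩

/-- A third of an integral power of two is within `1 / 3` of an integer. -/
lemma exists_int_abs_two_zpow_div_three_sub_le (m : ℤ) :
    ∃ q : ℤ, |(2 : ℝ) ^ m / 3 - q| ≤ 1 / 3 := by
  rcases le_total 0 m with hm | hm
  · lift m to ℕ using hm
    simpa using exists_int_abs_div_three_sub_le (2 ^ m)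
  · have hle : (2 : ℝ) ^ m ≤ 1 := zpow_le_one_of_nonpos₀ (by norm_num) hm
    have hpos : (0 : ℝ) < 2 ^ m := by positivity
    refine ⟨0, abs_le.2 ⟨?_, ?_⟩⟩ <;> push_cast <;> linarith

/-- Counterexample to relaxed set-formulation RPE.  Let `α > 1/6`, `j ≥ 0`, and
`φ = 2^{-j}/3`.  Then for every `k ≥ 0` there exist `ε` with `|ε| ≤ α` and an
integer `q` with `|q + ε - φ·2^k| < α`; consequently, with measured candidate set
at generation `k` given by `{2π(q + ε)/2^k : q ∈ ℤ}` (error `|ε| ≤ α`, true angle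
`0`), the false angle `2πφ` lies within circular distance `2πα·2^{-k}` of the
candidate set at generation `k`. -/
theorem stmt16 (α : ℝ) (hα : 1 / 6 < α) (j : ℕ) (k : ℕ) :
    ∃ ε : ℝ, |ε| ≤ α ∧ ∃ q : ℤ,
      |(q : ℝ) + ε - ((2 : ℝ) ^ (-(j : ℤ)) / 3) * 2 ^ k| < α ∧
      dist (((2 * π * ((2 : ℝ) ^ (-(j : ℤ)) / 3) : ℝ) : AddCircle (2 * π)))
        (((2 * π * ((q : ℝ) + ε) / 2 ^ k : ℝ) : AddCircle (2 * π))) <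
        2 * π * α / 2 ^ k := by
  have hpow : (2 : ℝ) ^ (-(j : ℤ)) / 3 * 2 ^ k = 2 ^ (-(j : ℤ) + k) / 3 := by
    rw [zpow_add₀ two_ne_zero, zpow_natCast]
    ring
  obtain ⟨q, hq⟩ := exists_int_abs_two_zpow_div_three_sub_le (-(j : ℤ) + k)
  rw [← hpow] at hq
  generalize (2 : ℝ) ^ (-(j : ℤ)) / 3 = φ at hq ⊢
  obtain ⟨hl, hu⟩ := abs_le.1 hq
  have hclose : |(q : ℝ) + (φ * 2 ^ k - q) / 2 - φ * 2 ^ k| < α :=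
    abs_lt.2 ⟨by linarith, by linarith⟩
  refine ⟨(φ * 2 ^ k - q) / 2, abs_le.2 ⟨by linarith, by linarith⟩, q, hclose, ?_⟩
  refine (AddCircle.dist_coe_le_abs_sub _ _ _).trans_lt ?_
  have hscale : 2 * π * φ - 2 * π * (q + (φ * 2 ^ k - q) / 2) / 2 ^ k =
      2 * π / 2 ^ k * (φ * 2 ^ k - (q + (φ * 2 ^ k - q) / 2)) := by
    field_simp
  rw [hscale, abs_mul, abs_of_pos (by positivity), abs_sub_comm, mul_div_right_comm (2 * π) α]
  gcongr
end

section
/- Assume the RPE setup with K ≥ k + 1. If θ̃ is an angle with θ̃ ∈ Φ_k and d(θ̃, Θ_k) + d(θ̃, Θ_{k+1}) < π/N_{k+1}, then d(θ̂_k, Θ_{k+1}) < π/N_{k+1}; consequently there is a unique element of Θ_{k+1} at minimal circular distance from θ̂_k. -/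
open Real Metric Set

/-- Two candidates at circular distance less than the spacing `2π / N` coincide. -/
theorem candSet_eq_of_dist_lt {N : ℕ} {φ : ℝ} {x y : AddCircle (2 * π)}
    (hx : x ∈ candSet N φ) (hy : y ∈ candSet N φ) (h : dist x y < 2 * π / N) : x = y := by
  obtain ⟨n, rfl⟩ := hx
  obtain ⟨m, rfl⟩ := hy
  rcases N.eq_zero_or_pos with rfl | hN
  · simp at h
  have hN' : (0 : ℝ) < N := by exact_mod_cast hN
  have hstep : 0 < 2 * π / N := by positivity
  rw [dist_eq_norm, ← AddCircle.coe_sub, AddCircle.norm_eq] at h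
  set q := round ((2 * π)⁻¹ * ((φ + 2 * π * n) / N - (φ + 2 * π * m) / N))
  have hmul : (φ + 2 * π * n) / N - (φ + 2 * π * m) / N - q * (2 * π)
      = 2 * π / N * ((n - m - N * q : ℤ) : ℝ) := by
    push_cast
    field_simp
    ring
  have hlt : |((n - m - N * q : ℤ) : ℝ)| < 1 := by
    rw [hmul, abs_mul, abs_of_pos hstep] at h
    exact (mul_lt_iff_lt_one_right hstep).mp h
  have hzero : n - m - N * q = 0 := Int.abs_lt_one_iff.mp (by exact_mod_cast hlt)
  rw [hzero, Int.cast_zero, mul_zero, sub_eq_zero] at hmul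
  rw [← sub_eq_zero, ← AddCircle.coe_sub, AddCircle.coe_eq_zero_iff]
  exact ⟨q, by rw [hmul, zsmul_eq_mul]⟩

/-- A candidate within half the spacing of `θ` is a nearest candidate to `θ`. -/
theorem infDist_candSet_eq_dist {N : ℕ} {φ : ℝ} {θ x : AddCircle (2 * π)}
    (hx : x ∈ candSet N φ) (h : dist θ x < π / N) : infDist θ (candSet N φ) = dist θ x := by
  refine le_antisymm (infDist_le_dist_of_mem hx) ((le_infDist ⟨x, hx⟩).mpr fun y hy => ?_)
  by_contra! hlt
  have hxy : dist x y < 2 * π / N := by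
    have := dist_triangle_left x y θ
    have : 2 * π / N = π / N + π / N := by ring
    linarith
  exact hlt.ne' (by rw [candSet_eq_of_dist_lt hx hy hxy])

/-- In the RPE setup with `k + 1 ≤ K`: if `θ` is an angle with `θ ∈ Φ k` and
`d(θ, Θ k) + d(θ, Θ (k+1)) < π / N (k+1)`, then
`d(θhat k, Θ (k+1)) < π / N (k+1)`; consequently there is a unique element of
`Θ (k+1)` at minimal circular distance from `θhat k`. -/
theorem stmt18 (K : ℕ) (r : RPE K) (k : ℕ) (hk : k + 1 ≤ K)
    (θ : AddCircle (2 * π)) (hΦ : θ ∈ r.Φ k)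
    (hsum : infDist θ (r.Θ k) + infDist θ (r.Θ (k + 1)) < π / (r.N (k + 1) : ℝ)) :
    infDist (r.θhat k) (r.Θ (k + 1)) < π / (r.N (k + 1) : ℝ) ∧
    ∃! x, x ∈ r.Θ (k + 1) ∧
      dist (r.θhat k) x = infDist (r.θhat k) (r.Θ (k + 1)) := by
  have hclose : infDist (r.θhat k) (r.Θ (k + 1)) < π / (r.N (k + 1) : ℝ) := by
    have hdist : infDist θ (r.Θ k) = dist θ (r.θhat k) :=
      infDist_candSet_eq_dist (r.hmem k (by lia)) hΦ
    have := infDist_le_infDist_add_dist (s := r.Θ (k + 1)) (x := r.θhat k) (y := θ)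
    rw [dist_comm] at this
    linarith
  have hmem : r.θhat (k + 1) ∈ r.Θ (k + 1) := r.hmem (k + 1) hk
  refine ⟨hclose, r.θhat (k + 1), ⟨hmem, le_antisymm ?_ (infDist_le_dist_of_mem hmem)⟩, ?_⟩
  · exact (le_infDist ⟨_, hmem⟩).mpr fun x hx => r.hmin (k + 1) (by lia) hk x hx
  · rintro x ⟨hx, hxdist⟩
    refine candSet_eq_of_dist_lt hx hmem ?_
    have hle : dist (r.θhat k) (r.θhat (k + 1)) ≤ dist (r.θhat k) x :=
      r.hmin (k + 1) (by lia) hk x hx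
    have := dist_triangle_left x (r.θhat (k + 1)) (r.θhat k)
    have : 2 * π / (r.N (k + 1) : ℝ) = π / r.N (k + 1) + π / r.N (k + 1) := by ring
    linarith
end
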